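/- arXiv:1608.02418 — 2 statements merged into one kernel-verified Lean document; each statement's English description precedes it below -/
import Mathlib

section
/- Let C be a finite dimensional algebra of global dimension exactly 2 and M a finitely generated C-module. Then pd_C M ≤ 1 if and only if Hom_C(τ_C^{-1} Ω_C^{-1} C, M) = 0, where τ_C is the Auslander–Reiten translate and Ω_C^{-1} denotes the first cosyzygy. -/
open CategoryTheory MulOpposite

open CategoryTheory MulOpposite

/-! Core definitions: right `A`-modules are modules over `Aᵐᵒᵖ`. -/

/-- The category of (small) modules over a ring `R`.  For a `k`-algebra `A`,
right `A`-modules are `Mdl Aᵐᵒᵖ`. -/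
abbrev Mdl (R : Type) [Ring R] := ModuleCat.{0} R

section Generic

variable (R : Type) [Ring R]

/-- `f : P → M` is a projective cover: `P` projective, `f` surjective with
superfluous kernel. -/
def IsProjCover {P M : Mdl R} (f : P →ₗ[R] M) : Prop :=
  Module.Projective R P ∧ Function.Surjective f ∧
    ∀ N : Submodule R P, N ⊔ LinearMap.ker f = ⊤ → N = ⊤

/-- `f : M → I` is an injective envelope: `I` injective, `f` injective with
essential image. -/
def IsInjEnv {M I : Mdl R} (f : M →ₗ[R] I) : Prop :=
  Module.Injective R I ∧ Function.Injective f ∧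
    ∀ K : Submodule R I, K ⊓ LinearMap.range f = ⊥ → K = ⊥

/-- `Hom_R(X, Y) = 0`. -/
def HomZero (X Y : Mdl R) : Prop := ∀ f : X →ₗ[R] Y, f = 0

/-- `X ∈ Gen M`: `X` is an epimorphic image of a finite direct sum of copies of `M`. -/
def MemGen (M X : Mdl R) : Prop :=
  ∃ (d : ℕ) (f : (Fin d → M) →ₗ[R] X), Function.Surjective f

/-- `X ∈ add M`: `X` is a direct summand of a finite direct sum of copies of `M`. -/
def MemAdd (M X : Mdl R) : Prop :=
  ∃ (n : ℕ) (s : X →ₗ[R] (Fin n → M)) (r : (Fin n → M) →ₗ[R] X),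
    r.comp s = LinearMap.id

/-- projective dimension at most 1: a length-one projective resolution exists. -/
def PdLE1 (M : Mdl R) : Prop :=
  ∃ (P1 P0 : Mdl R) (d1 : P1 →ₗ[R] P0) (d0 : P0 →ₗ[R] M),
    Module.Projective R P1 ∧ Module.Projective R P0 ∧
    Function.Injective d1 ∧ Function.Surjective d0 ∧
    LinearMap.range d1 = LinearMap.ker d0

/-- projective dimension at most 2. -/
def PdLE2 (M : Mdl R) : Prop :=
  ∃ (P2 P1 P0 : Mdl R) (d2 : P2 →ₗ[R] P1) (d1 : P1 →ₗ[R] P0) (d0 : P0 →ₗ[R] M),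
    Module.Projective R P2 ∧ Module.Projective R P1 ∧ Module.Projective R P0 ∧
    Function.Injective d2 ∧ Function.Surjective d0 ∧
    LinearMap.range d2 = LinearMap.ker d1 ∧ LinearMap.range d1 = LinearMap.ker d0

/-- injective dimension at most 1. -/
def IdLE1 (M : Mdl R) : Prop :=
  ∃ (I0 I1 : Mdl R) (d0 : M →ₗ[R] I0) (d1 : I0 →ₗ[R] I1),
    Module.Injective R I0 ∧ Module.Injective R I1 ∧
    Function.Injective d0 ∧ Function.Surjective d1 ∧
    LinearMap.range d0 = LinearMap.ker d1

/-- global dimension at most 2 (every module has projective dimension ≤ 2). -/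
def GlDimLE2 : Prop := ∀ M : Mdl R, PdLE2 R M

/-- global dimension exactly 2. -/
def GlDimEq2 : Prop := GlDimLE2 R ∧ ¬ ∀ M : Mdl R, PdLE1 R M

/-- `W` is a first syzygy `Ω M` of `M` (kernel of a projective cover). -/
def IsSyzygy (M W : Mdl R) : Prop :=
  ∃ (P : Mdl R) (f : P →ₗ[R] M), IsProjCover R f ∧
    Nonempty (W ≃ₗ[R] LinearMap.ker f)

/-- `W` is a first cosyzygy `Ω⁻¹ M` of `M` (cokernel of an injective envelope). -/
def IsCosyzygy (M W : Mdl R) : Prop :=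
  ∃ (I : Mdl R) (f : M →ₗ[R] I), IsInjEnv R f ∧
    Nonempty (W ≃ₗ[R] (I ⧸ LinearMap.range f))

/-- `P1 --d1--> P0 --d0--> M → 0` is a minimal projective presentation. -/
def IsMinPres {P1 P0 M : Mdl R} (d1 : P1 →ₗ[R] P0) (d0 : P0 →ₗ[R] M) : Prop :=
  IsProjCover R d0 ∧ Module.Projective R P1 ∧
  LinearMap.range d1 = LinearMap.ker d0 ∧
  ∀ N : Submodule R P1, N ⊔ LinearMap.ker d1 = ⊤ → N = ⊤

/-- `Ext¹_R(X, Y) = 0`, expressed as: every short exact sequence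
`0 → Y → Z → X → 0` splits. -/
def Ext1Zero (X Y : Mdl R) : Prop :=
  ∀ (Z : Mdl R) (i : Y →ₗ[R] Z) (p : Z →ₗ[R] X),
    Function.Injective i → Function.Surjective p →
    LinearMap.range i = LinearMap.ker p →
    ∃ s : X →ₗ[R] Z, p.comp s = LinearMap.id

/-- partial tilting module: `pd ≤ 1` and `Ext¹(M,M) = 0`. -/
def PartialTilting (M : Mdl R) : Prop := PdLE1 R M ∧ Ext1Zero R M M

/-- tilting module: partial tilting plus a coresolution
`0 → R → T' → T'' → 0` with `T', T'' ∈ add M` of the regular module. -/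
def IsTilting (M : Mdl R) : Prop :=
  PartialTilting R M ∧
  ∃ (T' T'' : Mdl R) (i : ModuleCat.of R R →ₗ[R] T') (p : T' →ₗ[R] T''),
    MemAdd R M T' ∧ MemAdd R M T'' ∧
    Function.Injective i ∧ Function.Surjective p ∧
    LinearMap.range i = LinearMap.ker p

/-- an indecomposable (nonzero) module. -/
def Indecomp (M : Mdl R) : Prop :=
  Nontrivial M ∧ ∀ (U V : Submodule R M), IsCompl U V → U = ⊥ ∨ V = ⊥

/-- the number of isomorphism classes of simple `R`-modules is `n`. -/
def SimpleCount (n : ℕ) : Prop :=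
  ∃ S : Fin n → Mdl R,
    (∀ i, IsSimpleModule R (S i)) ∧
    (∀ i j, Nonempty ((S i) ≃ₗ[R] (S j)) → i = j) ∧
    ∀ X : Mdl R, IsSimpleModule R X → ∃ i, Nonempty (X ≃ₗ[R] S i)

end Generic

section Duality

variable (k : Type) [Field k] (A : Type) [Ring A] [Algebra k A]

/-- `N` (a right `A`-module) is the `k`-linear dual `D M` of the left `A`-module `M`:
witnessed by a nondegenerate balanced `k`-bilinear pairing. -/
def IskDual (N : Mdl Aᵐᵒᵖ) (M : Mdl A) : Prop :=
  ∃ φ : N → M → k,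
    (∀ n n' m, φ (n + n') m = φ n m + φ n' m) ∧
    (∀ n m m', φ n (m + m') = φ n m + φ n m') ∧
    (∀ (c : k) n m, φ n ((algebraMap k A c) • m) = c * φ n m) ∧
    (∀ (a : A) n m, φ (op a • n) m = φ n (a • m)) ∧
    (∀ n, (∀ m, φ n m = 0) → n = 0) ∧
    (∀ m, (∀ n, φ n m = 0) → m = 0)

/-- `T = τ M`: the Auslander–Reiten translate of the right `A`-module `M`,
i.e. the `k`-dual of the transpose `Tr M` computed from a minimal projective
presentation. -/
def IsTau (M T : Mdl Aᵐᵒᵖ) : Prop :=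
  ∃ (P1 P0 : Mdl Aᵐᵒᵖ) (d1 : P1 →ₗ[Aᵐᵒᵖ] P0) (d0 : P0 →ₗ[Aᵐᵒᵖ] M),
    IsMinPres Aᵐᵒᵖ d1 d0 ∧
    ∃ (Tr : Mdl A) (q : (P1 →ₗ[Aᵐᵒᵖ] A) →ₗ[A] Tr),
      Function.Surjective q ∧
      (∀ g : P1 →ₗ[Aᵐᵒᵖ] A, q g = 0 ↔ ∃ f : P0 →ₗ[Aᵐᵒᵖ] A, g = f.comp d1) ∧
      IskDual k A T Tr

/-- `T = τ⁻¹ M`: the inverse Auslander–Reiten translate, `Tr (D M)`, computed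
from a minimal projective presentation of the left module `D M`. -/
def IsTauInv (M T : Mdl Aᵐᵒᵖ) : Prop :=
  ∃ (DM : Mdl A), IskDual k A M DM ∧
  ∃ (Q1 Q0 : Mdl A) (d1 : Q1 →ₗ[A] Q0) (d0 : Q0 →ₗ[A] DM),
    IsMinPres A d1 d0 ∧
    ∃ q : (Q1 →ₗ[A] A) →ₗ[Aᵐᵒᵖ] T,
      Function.Surjective q ∧
      ∀ g : Q1 →ₗ[A] A, q g = 0 ↔ ∃ f : Q0 →ₗ[A] A, g = f.comp d1

/-- `W = τ⁻¹ Ω⁻¹ M`. -/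
def IsTauInvCosyz (M W : Mdl Aᵐᵒᵖ) : Prop :=
  ∃ V, IsCosyzygy Aᵐᵒᵖ M V ∧ IsTauInv k A V W

/-- `W = τ Ω M`. -/
def IsTauSyz (M W : Mdl Aᵐᵒᵖ) : Prop :=
  ∃ V, IsSyzygy Aᵐᵒᵖ M V ∧ IsTau k A V W

/-- `M` is `τ`-rigid: `Hom(M, τM) = 0`. -/
def TauRigid (M : Mdl Aᵐᵒᵖ) : Prop :=
  ∀ T, IsTau k A M T → HomZero Aᵐᵒᵖ M T

/-- `M` is `τ`-tilting: `τ`-rigid with as many pairwise nonisomorphic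
indecomposable summands as there are simple modules. -/
def TauTilting (M : Mdl Aᵐᵒᵖ) : Prop :=
  TauRigid k A M ∧
  ∃ (n : ℕ) (N : Fin n → Mdl Aᵐᵒᵖ),
    (∀ i, Indecomp Aᵐᵒᵖ (N i)) ∧
    (∀ i j, Nonempty ((N i) ≃ₗ[Aᵐᵒᵖ] (N j)) → i = j) ∧
    Nonempty (M ≃ₗ[Aᵐᵒᵖ] ((i : Fin n) → N i)) ∧
    SimpleCount Aᵐᵒᵖ n

end Duality


section Homological

variable {R : Type} [Ring R]

lemma ses_mk {X Y Z : Mdl R} (f : X →ₗ[R] Y) (g : Y →ₗ[R] Z)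
    (hf : Function.Injective f) (hg : Function.Surjective g)
    (h : LinearMap.range f = LinearMap.ker g) :
    ∃ w : ModuleCat.ofHom f ≫ ModuleCat.ofHom g = 0,
      (ShortComplex.mk (ModuleCat.ofHom f) (ModuleCat.ofHom g) w).ShortExact := by
  have hw : ModuleCat.ofHom f ≫ ModuleCat.ofHom g = 0 := by
    ext x
    have : f x ∈ LinearMap.ker g := h ▸ LinearMap.mem_range_self f x
    simpa using this
  refine ⟨hw, ?_⟩
  refine { exact := ?_, mono_f := ?_, epi_g := ?_ }
  · rw [ShortComplex.moduleCat_exact_iff_range_eq_ker]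
    exact h
  · exact (ModuleCat.mono_iff_injective _).2 hf
  · exact (ModuleCat.epi_iff_surjective _).2 hg

lemma proj_obj (P : Mdl R) (h : Module.Projective R P) : Projective P :=
  (IsProjective.iff_projective (R := R) P).1 h

lemma inj_obj (P : Mdl R) (h : Module.Injective R P) : Injective P :=
  (Module.injective_iff_injective_object R P).1 h

lemma pdlt_of_ses {X Y Z : Mdl R} (f : X →ₗ[R] Y) (g : Y →ₗ[R] Z)
    (hf : Function.Injective f) (hg : Function.Surjective g)
    (h : LinearMap.range f = LinearMap.ker g) (hY : Module.Projective R Y) (n : ℕ) :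
    HasProjectiveDimensionLT Z (n + 2) ↔ HasProjectiveDimensionLT X (n + 1) := by
  obtain ⟨w, hS⟩ := ses_mk f g hf hg h
  exact hS.hasProjectiveDimensionLT_X₃_iff n (proj_obj Y hY)

lemma idlt_of_ses {X Y Z : Mdl R} (f : X →ₗ[R] Y) (g : Y →ₗ[R] Z)
    (hf : Function.Injective f) (hg : Function.Surjective g)
    (h : LinearMap.range f = LinearMap.ker g) (hY : Module.Injective R Y) (n : ℕ) :
    HasInjectiveDimensionLT X (n + 2) ↔ HasInjectiveDimensionLT Z (n + 1) := by
  obtain ⟨w, hS⟩ := ses_mk f g hf hg h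
  exact (hS.hasInjectiveDimensionLT_X₃_iff n (inj_obj Y hY)).symm

lemma pdlt_two {M : Mdl R} (h : PdLE1 R M) : HasProjectiveDimensionLT M 2 := by
  obtain ⟨P1, P0, d1, d0, h1, h0, i1, s0, e⟩ := h
  rw [pdlt_of_ses d1 d0 i1 s0 e h0 0]
  have := proj_obj P1 h1
  infer_instance

lemma pdlt_three {M : Mdl R} (h : PdLE2 R M) : HasProjectiveDimensionLT M 3 := by
  obtain ⟨P2, P1, P0, d2, d1, d0, h2, h1, h0, i2, s0, e1, e0⟩ := h
  rw [pdlt_of_ses (X := ModuleCat.of R (LinearMap.ker d0)) (LinearMap.ker d0).subtype d0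
    Subtype.val_injective s0 (by simp) h0 1]
  rw [pdlt_of_ses (Z := ModuleCat.of R (LinearMap.ker d0)) d2
    (LinearMap.codRestrict (LinearMap.ker d0) d1 (fun c => e0 ▸ LinearMap.mem_range_self d1 c))
    i2 ?_ ?_ h1 0]
  · have := proj_obj P2 h2
    infer_instance
  · rintro ⟨x, hx⟩
    rw [← e0] at hx
    obtain ⟨y, rfl⟩ := hx
    exact ⟨y, rfl⟩
  · rw [LinearMap.ker_codRestrict]; exact e1

open Abelian

lemma ext_one_iff_lift {X Y Z : Mdl R} (f : X →ₗ[R] Y) (g : Y →ₗ[R] Z)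
    (hf : Function.Injective f) (hg : Function.Surjective g)
    (h : LinearMap.range f = LinearMap.ker g) (hY : Module.Injective R Y) (M : Mdl R) :
    Subsingleton (Ext.{0} M X 1) ↔
      ∀ b : M →ₗ[R] Z, ∃ c : M →ₗ[R] Y, g.comp c = b := by
  obtain ⟨w, hS⟩ := ses_mk f g hf hg h
  have hYi := inj_obj Y hY
  constructor
  · intro hs b
    obtain ⟨x, hx⟩ := Ext.covariant_sequence_exact₃ M hS (Ext.mk₀ (ModuleCat.ofHom b)) (n₁ := 1)
      rfl (Subsingleton.elim (α := Ext.{0} M X 1) _ _)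
    obtain ⟨c, rfl⟩ := (Ext.mk₀_bijective M Y).2 x
    refine ⟨c.hom, ?_⟩
    rw [Ext.mk₀_comp_mk₀] at hx
    have := (Ext.mk₀_bijective _ _).1 hx
    exact congrArg ModuleCat.Hom.hom this
  · intro H
    refine subsingleton_of_forall_eq 0 fun e => ?_
    obtain ⟨x, hx⟩ := Ext.covariant_sequence_exact₁ M hS e
      (Ext.eq_zero_of_hasInjectiveDimensionLT (X := Y) _ 1 le_rfl) (n₀ := 0) rfl
    obtain ⟨b, rfl⟩ := (Ext.mk₀_bijective M Z).2 x
    obtain ⟨c, hc⟩ := H b.hom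
    have hb : b = ModuleCat.ofHom c ≫ ModuleCat.ofHom g := by
      ext y; exact (LinearMap.congr_fun hc y).symm
    rw [← hx, hb, ← Ext.mk₀_comp_mk₀]
    have := hS.comp_extClass
    rw [Ext.comp_assoc_of_second_deg_zero]
    erw [this]
    simp

lemma ext_shift_inj {X Y Z : Mdl R} (f : X →ₗ[R] Y) (g : Y →ₗ[R] Z)
    (hf : Function.Injective f) (hg : Function.Surjective g)
    (h : LinearMap.range f = LinearMap.ker g) (hY : Module.Injective R Y) (M : Mdl R) :
    Subsingleton (Ext.{0} M X 2) ↔ Subsingleton (Ext.{0} M Z 1) := by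
  obtain ⟨w, hS⟩ := ses_mk f g hf hg h
  have hYi := inj_obj Y hY
  constructor
  · intro hs
    refine subsingleton_of_forall_eq 0 fun e => ?_
    obtain ⟨x, hx⟩ := Ext.covariant_sequence_exact₃ M hS e (n₁ := 2)
      rfl (Subsingleton.elim (α := Ext.{0} M X 2) _ _)
    rw [← hx, Ext.eq_zero_of_hasInjectiveDimensionLT (X := Y) x 1 le_rfl]
    simp
  · intro H
    refine subsingleton_of_forall_eq 0 fun e => ?_
    obtain ⟨x, hx⟩ := Ext.covariant_sequence_exact₁ M hS e
      (Ext.eq_zero_of_hasInjectiveDimensionLT (X := Y) _ 1 (by norm_num)) (n₀ := 1) rfl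
    have : x = 0 := Subsingleton.elim (α := Ext.{0} M Z 1) _ _
    rw [← hx, this]
    simp

lemma ext_shift_proj {X Y Z : Mdl R} (f : X →ₗ[R] Y) (g : Y →ₗ[R] Z)
    (hf : Function.Injective f) (hg : Function.Surjective g)
    (h : LinearMap.range f = LinearMap.ker g) (hY : Module.Projective R Y) (A : Mdl R)
    (hs : Subsingleton (Ext.{0} Z A 2)) : Subsingleton (Ext.{0} X A 1) := by
  obtain ⟨w, hS⟩ := ses_mk f g hf hg h
  have hYi := proj_obj Y hY
  refine subsingleton_of_forall_eq 0 fun e => ?_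
  obtain ⟨x, hx⟩ := Ext.contravariant_sequence_exact₁ hS A e (n₁ := 2)
      rfl (Subsingleton.elim (α := Ext.{0} Z A 2) _ _)
  rw [← hx, Ext.eq_zero_of_hasProjectiveDimensionLT (X := Y) x 1 le_rfl]
  simp

lemma extend_of_ext {X Y Z : Mdl R} (f : X →ₗ[R] Y) (g : Y →ₗ[R] Z)
    (hf : Function.Injective f) (hg : Function.Surjective g)
    (h : LinearMap.range f = LinearMap.ker g) (A : Mdl R)
    (hs : Subsingleton (Ext.{0} Z A 1)) (b : X →ₗ[R] A) : ∃ c : Y →ₗ[R] A, c.comp f = b := by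
  obtain ⟨w, hS⟩ := ses_mk f g hf hg h
  obtain ⟨x, hx⟩ := Ext.contravariant_sequence_exact₁ hS A (Ext.mk₀ (ModuleCat.ofHom b)) (n₁ := 1)
      rfl (Subsingleton.elim (α := Ext.{0} Z A 1) _ _)
  obtain ⟨c, rfl⟩ := (Ext.mk₀_bijective Y A).2 x
  refine ⟨c.hom, ?_⟩
  rw [Ext.mk₀_comp_mk₀] at hx
  have := (Ext.mk₀_bijective _ _).1 hx
  exact congrArg ModuleCat.Hom.hom this

/-- dual bases of finitely generated projective modules -/
lemma exists_dual_basis (Q : Type) [AddCommGroup Q] [Module R Q] [Module.Finite R Q]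
    [Module.Projective R Q] :
    ∃ (n : ℕ) (q : Fin n → Q) (s : Fin n → Q →ₗ[R] R), ∀ x, ∑ i, s i x • q i = x := by
  obtain ⟨n, f, hf⟩ := Module.Finite.exists_fin' R Q
  obtain ⟨g, hg⟩ := Module.projective_lifting_property f LinearMap.id hf
  refine ⟨n, fun i => f (Pi.single i 1), fun i => (LinearMap.proj i).comp g, fun x => ?_⟩
  have : f (g x) = x := LinearMap.congr_fun hg x
  conv_rhs => rw [← this, pi_eq_sum_univ' (g x)]
  rw [map_sum]
  refine Finset.sum_congr rfl fun i _ => ?_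
  simp only [LinearMap.comp_apply, LinearMap.proj_apply]
  rw [← map_smul]

lemma pdle1_of_ext [IsNoetherianRing R] (M : Mdl R) [Module.Finite R M]
    (hp : HasProjectiveDimensionLT M 3) (A : Mdl R) (e : A ≃ₗ[R] R)
    (hs : Subsingleton (Ext.{0} M A 2)) : PdLE1 R M := by
  obtain ⟨n, f, hf⟩ := Module.Finite.exists_fin' R M
  let P : Mdl R := ModuleCat.of R (Fin n → R)
  let f' : P →ₗ[R] M := f
  let K : Mdl R := ModuleCat.of R (LinearMap.ker f')
  have : Module.Finite R K := inferInstanceAs (Module.Finite R (LinearMap.ker f))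
  have hP : Module.Projective R P := inferInstanceAs (Module.Projective R (Fin n → R))
  let ι : K →ₗ[R] P := (LinearMap.ker f').subtype
  have hι : Function.Injective ι := Subtype.val_injective
  have he : LinearMap.range ι = LinearMap.ker f' := by simp [ι, K]
  have hK := ext_shift_proj ι f' hι hf he hP A hs
  rw [pdlt_of_ses ι f' hι hf he hP 1] at hp
  obtain ⟨m, g, hg⟩ := Module.Finite.exists_fin' R K
  let F : Mdl R := ModuleCat.of R (Fin m → R)
  let g' : F →ₗ[R] K := g
  let K' : Mdl R := ModuleCat.of R (LinearMap.ker g')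
  have : Module.Finite R K' := inferInstanceAs (Module.Finite R (LinearMap.ker g))
  have hF : Module.Projective R F := inferInstanceAs (Module.Projective R (Fin m → R))
  let κ : K' →ₗ[R] F := (LinearMap.ker g').subtype
  have hκ : Function.Injective κ := Subtype.val_injective
  have he' : LinearMap.range κ = LinearMap.ker g' := by simp [κ, K']
  rw [pdlt_of_ses κ g' hκ hg he' hF 0] at hp
  have : Module.Projective R K' :=
    (IsProjective.iff_projective (R := R) K').2 (projective_iff_hasProjectiveDimensionLT_one.2 hp)
  obtain ⟨l, q, s, hq⟩ := exists_dual_basis (R := R) K'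
  have hext : ∀ i, ∃ c : F →ₗ[R] R, c.comp κ = s i := by
    intro i
    obtain ⟨c, hc⟩ := extend_of_ext κ g' hκ hg he' A hK (e.symm.toLinearMap.comp (s i))
    refine ⟨e.toLinearMap.comp c, ?_⟩
    rw [LinearMap.comp_assoc, hc]
    ext x; simp
  choose c hc using hext
  let r : F →ₗ[R] K' := ∑ i, (c i).smulRight (q i)
  have hr : r.comp κ = LinearMap.id := by
    ext1 x
    have : ∀ i, c i (κ x) = s i x := fun i => LinearMap.congr_fun (hc i) x
    simp only [r, LinearMap.comp_apply, LinearMap.sum_apply, LinearMap.smulRight_apply, this, hq,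
      LinearMap.id_apply]
  -- a section of g'
  have hKp : Module.Projective R K := by
    let t : F →ₗ[R] F := LinearMap.id - κ.comp r
    have ht : LinearMap.ker g' ≤ LinearMap.ker t := by
      rw [← he']
      rintro _ ⟨y, rfl⟩
      have : r (κ y) = y := LinearMap.congr_fun hr y
      simp [t, this]
    let eq := LinearMap.quotKerEquivOfSurjective g' hg
    let sec : K →ₗ[R] F := ((LinearMap.ker g').liftQ t ht).comp eq.symm.toLinearMap
    refine Module.Projective.of_split (M := F) sec g' ?_
    ext1 x
    obtain ⟨y, rfl⟩ := hg x
    have h1 : eq.symm (g y) = Submodule.Quotient.mk y := by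
      rw [LinearEquiv.symm_apply_eq]; rfl
    have h2 : g' (κ (r y)) = 0 := (r y).2
    have h3 : sec (g y) = y - κ (r y) := by
      simp only [sec, LinearMap.comp_apply, LinearEquiv.coe_coe, h1]
      rfl
    simp only [LinearMap.comp_apply, LinearMap.id_apply]
    rw [h3, map_sub, h2, sub_zero]
  exact ⟨K, P, ι, f', hKp, hP, hι, hf, he⟩

end Homological

section DualModules

variable (k : Type) [Field k] {C : Type} [Ring C] [Algebra k C]

/-- The `k`-dual of a left `C`-module, as a right `C`-module. -/
def RD (Q : Type) [AddCommGroup Q] [Module k Q] : Type := Q →ₗ[k] k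

noncomputable instance (Q : Type) [AddCommGroup Q] [Module k Q] : AddCommGroup (RD k Q) :=
  inferInstanceAs (AddCommGroup (Q →ₗ[k] k))

instance (Q : Type) [AddCommGroup Q] [Module k Q] : FunLike (RD k Q) Q k :=
  inferInstanceAs (FunLike (Q →ₗ[k] k) Q k)

instance (Q : Type) [AddCommGroup Q] [Module k Q] : LinearMapClass (RD k Q) k Q k :=
  inferInstanceAs (LinearMapClass (Q →ₗ[k] k) k Q k)

section
variable {k}
variable {Q : Type} [AddCommGroup Q] [Module k Q]

@[ext] lemma RD.ext {f g : RD k Q} (h : ∀ x, f x = g x) : f = g := LinearMap.ext h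

lemma RD.add_apply (f g : RD k Q) (x : Q) : (f + g) x = f x + g x := rfl
lemma RD.zero_apply (x : Q) : (0 : RD k Q) x = 0 := rfl

variable [Module C Q] [IsScalarTower k C Q]

noncomputable instance : Module Cᵐᵒᵖ (RD k Q) where
  smul a f := LinearMap.comp (M₃ := k) (R₃ := k) f
    ({ toFun := fun q => unop a • q
       map_add' := fun x y => smul_add _ x y
       map_smul' := fun c x => (smul_comm c (unop a) x).symm } : Q →ₗ[k] Q)
  one_smul f := by ext x; show f ((1 : C) • x) = f x; rw [one_smul]
  mul_smul a b f := by
    ext x; show f ((unop b * unop a) • x) = f (unop b • unop a • x); rw [mul_smul]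
  smul_zero a := by ext x; rfl
  smul_add a f g := by ext x; rfl
  add_smul a b f := by
    ext x; show f ((unop a + unop b) • x) = f (unop a • x) + f (unop b • x)
    rw [add_smul, map_add]
  zero_smul f := by ext x; show f ((0 : C) • x) = 0; rw [zero_smul, map_zero]

lemma RD.smul_apply (a : Cᵐᵒᵖ) (f : RD k Q) (x : Q) : (a • f) x = f (unop a • x) := rfl

end

variable {k}

/-- The dual of a linear map. -/
def RDmap {Q Q' : Type} [AddCommGroup Q] [Module k Q] [Module C Q] [IsScalarTower k C Q]
    [AddCommGroup Q'] [Module k Q'] [Module C Q'] [IsScalarTower k C Q'] (d : Q →ₗ[C] Q') :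
    RD k Q' →ₗ[Cᵐᵒᵖ] RD k Q where
  toFun f := LinearMap.comp (M₃ := k) (R₃ := k) f (d.restrictScalars k)
  map_add' f g := rfl
  map_smul' a f := by
    ext x
    show f (unop a • d x) = f (d (unop a • x))
    rw [d.map_smul]

lemma RDmap_apply {Q Q' : Type} [AddCommGroup Q] [Module k Q] [Module C Q] [IsScalarTower k C Q]
    [AddCommGroup Q'] [Module k Q'] [Module C Q'] [IsScalarTower k C Q'] (d : Q →ₗ[C] Q')
    (f : RD k Q') (x : Q) : RDmap d f x = f (d x) := rfl

/-- Build a map to the dual from a balanced form. -/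
def RDform {M Q : Type} [AddCommGroup Q] [Module k Q] [Module C Q] [IsScalarTower k C Q]
    [AddCommGroup M] [Module Cᵐᵒᵖ M] (φ : M → Q → k)
    (h1 : ∀ m m' q, φ (m + m') q = φ m q + φ m' q)
    (h2 : ∀ m q q', φ m (q + q') = φ m q + φ m q')
    (h3 : ∀ (c : k) m q, φ m (c • q) = c * φ m q)
    (h4 : ∀ (a : C) m q, φ (op a • m) q = φ m (a • q)) : M →ₗ[Cᵐᵒᵖ] RD k Q where
  toFun m := ({ toFun := φ m, map_add' := h2 m, map_smul' := fun c q => h3 c m q } : Q →ₗ[k] k)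
  map_add' m m' := by ext q; exact h1 m m' q
  map_smul' a m := by ext q; exact h4 (unop a) m q

lemma RDform_apply {M Q : Type} [AddCommGroup Q] [Module k Q] [Module C Q] [IsScalarTower k C Q]
    [AddCommGroup M] [Module Cᵐᵒᵖ M] (φ : M → Q → k) (h1) (h2) (h3) (h4) (m : M) (q : Q) :
    RDform (C := C) φ h1 h2 h3 h4 m q = φ m q := rfl

section
variable {Q : Type} [AddCommGroup Q] [Module k Q] [Module C Q] [IsScalarTower k C Q]

/-- The form `(m, q) ↦ ℓ (m · s(q))`. -/
def RDs {M : Type} [AddCommGroup M] [Module Cᵐᵒᵖ M] [Module k M] [IsScalarTower k Cᵐᵒᵖ M]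
    (l : M →ₗ[k] k) (s : Q →ₗ[C] C) : M →ₗ[Cᵐᵒᵖ] RD k Q :=
  RDform (fun m q => l (op (s q) • m))
    (fun m m' q => by simp) (fun m q q' => by simp [add_smul])
    (fun c m q => by
      have : op (s (c • q)) = c • op (s q) := by
        rw [← op_smul, LinearMap.map_smul_of_tower]
      simp [this])
    (fun a m q => by simp [mul_smul])

lemma RDs_apply {M : Type} [AddCommGroup M] [Module Cᵐᵒᵖ M] [Module k M] [IsScalarTower k Cᵐᵒᵖ M]
    (l : M →ₗ[k] k) (s : Q →ₗ[C] C) (m : M) (q : Q) :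
    RDs l s m q = l (op (s q) • m) := rfl

/-- evaluation at `q` is `k`-linear -/
noncomputable def RDeval {M : Type} [AddCommGroup M] [Module Cᵐᵒᵖ M] [Module k M] [IsScalarTower k Cᵐᵒᵖ M]
    (b : M →ₗ[Cᵐᵒᵖ] RD k Q) (q : Q) : M →ₗ[k] k where
  toFun m := b m q
  map_add' m m' := by rw [map_add]; rfl
  map_smul' c m := by
    have : c • m = (op (algebraMap k C c)) • m := by
      rw [← MulOpposite.algebraMap_apply, algebraMap_smul]
    rw [this, map_smul, RD.smul_apply, unop_op, algebraMap_smul, map_smul]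
    rfl

lemma RDeval_apply {M : Type} [AddCommGroup M] [Module Cᵐᵒᵖ M] [Module k M]
    [IsScalarTower k Cᵐᵒᵖ M] (b : M →ₗ[Cᵐᵒᵖ] RD k Q) (q : Q) (m : M) :
    RDeval b q m = b m q := rfl

lemma RD_injective [Module.Finite C Q] [Module.Projective C Q] :
    Module.Injective Cᵐᵒᵖ (RD k Q) := by
  refine ⟨fun X Y _ _ _ _ f hf g => ?_⟩
  let _ : Module k X := Module.restrictScalars k Cᵐᵒᵖ X
  let _ : Module k Y := Module.restrictScalars k Cᵐᵒᵖ Y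
  have : IsScalarTower k Cᵐᵒᵖ X := IsScalarTower.restrictScalars k Cᵐᵒᵖ X
  have : IsScalarTower k Cᵐᵒᵖ Y := IsScalarTower.restrictScalars k Cᵐᵒᵖ Y
  obtain ⟨n, q, s, hq⟩ := exists_dual_basis (R := C) Q
  obtain ⟨r, hr⟩ := LinearMap.exists_leftInverse_of_injective (f.restrictScalars k)
    (LinearMap.ker_eq_bot.2 hf)
  have hr' : ∀ x, r (f x) = x := fun x => LinearMap.congr_fun hr x
  refine ⟨∑ i, RDs ((RDeval g (q i)).comp r) (s i), fun x => ?_⟩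
  ext y
  have key : ∀ i, RDs ((RDeval g (q i)).comp r) (s i) (f x) y = g x (s i y • q i) := by
    intro i
    rw [RDs_apply, LinearMap.comp_apply, ← map_smul, hr', RDeval_apply, map_smul, RD.smul_apply,
      unop_op]
  have h2 : ∀ (t : Finset (Fin n)),
      (∑ i ∈ t, RDs ((RDeval g (q i)).comp r) (s i)) (f x) y = ∑ i ∈ t, g x (s i y • q i) := by
    intro t
    induction t using Finset.induction_on with
    | empty => rfl
    | insert a t ha ih =>
      rw [Finset.sum_insert ha, Finset.sum_insert ha, LinearMap.add_apply, RD.add_apply, ih, key]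
  rw [h2, ← map_sum, hq]

end

section
variable {Q1 Q0 : Type} [AddCommGroup Q1] [Module k Q1] [Module C Q1] [IsScalarTower k C Q1]
  [AddCommGroup Q0] [Module k Q0] [Module C Q0] [IsScalarTower k C Q0]
  {M : Type} [AddCommGroup M] [Module Cᵐᵒᵖ M]

/-- precomposition `Q0^* → Q1^*` -/
def preStar (d : Q1 →ₗ[C] Q0) : (Q0 →ₗ[C] C) →ₗ[Cᵐᵒᵖ] (Q1 →ₗ[C] C) where
  toFun f := f.comp d
  map_add' f g := rfl
  map_smul' a f := rfl

/-- `f ↦ m · f(q)` -/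
def evStar (m : M) (q : Q1) : (Q1 →ₗ[C] C) →ₗ[Cᵐᵒᵖ] M where
  toFun f := op (f q) • m
  map_add' f g := by simp [add_smul]
  map_smul' a f := by
    rw [LinearMap.smul_apply, RingHom.id_apply, smul_smul]
    rfl

lemma star_expand {n : ℕ} (q : Fin n → Q1) (s : Fin n → Q1 →ₗ[C] C)
    (hq : ∀ x, ∑ i, s i x • q i = x) (f : Q1 →ₗ[C] C) : ∑ i, op (f (q i)) • s i = f := by
  ext x
  conv_rhs => rw [← hq x, map_sum]
  rw [LinearMap.sum_apply]
  refine Finset.sum_congr rfl fun i _ => ?_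
  rw [LinearMap.smul_apply, map_smul]
  rfl

lemma lift_of_homzero [Module.Finite C Q1] [Module.Projective C Q1]
    (d : Q1 →ₗ[C] Q0)
    (H : ∀ h : (Q1 →ₗ[C] C) →ₗ[Cᵐᵒᵖ] M, h.comp (preStar d) = 0 → h = 0)
    (b : M →ₗ[Cᵐᵒᵖ] RD k Q1) : ∃ c : M →ₗ[Cᵐᵒᵖ] RD k Q0, (RDmap d).comp c = b := by
  let _ : Module k M := Module.restrictScalars k Cᵐᵒᵖ M
  have : IsScalarTower k Cᵐᵒᵖ M := IsScalarTower.restrictScalars k Cᵐᵒᵖ M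
  have : SMulCommClass Cᵐᵒᵖ k M := IsScalarTower.to_smulCommClass' 
  obtain ⟨n, q, s, hq⟩ := exists_dual_basis (R := C) Q1
  let T : ((Q1 →ₗ[C] C) →ₗ[Cᵐᵒᵖ] M) →ₗ[k] ((Q0 →ₗ[C] C) →ₗ[Cᵐᵒᵖ] M) :=
    { toFun := fun h => h.comp (preStar d)
      map_add' := fun _ _ => rfl
      map_smul' := fun _ _ => rfl }
  have hT : LinearMap.ker T = ⊥ := by
    rw [LinearMap.ker_eq_bot']
    exact H
  obtain ⟨r, hr⟩ := LinearMap.exists_leftInverse_of_injective T hT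
  have hr' : ∀ x, r (T x) = x := fun x => LinearMap.congr_fun hr x
  let p : ((Q1 →ₗ[C] C) →ₗ[Cᵐᵒᵖ] M) →ₗ[k] k :=
    { toFun := fun h => ∑ i, RDeval b (q i) (h (s i))
      map_add' := fun h h' => by
        simp only [LinearMap.add_apply, map_add, Finset.sum_add_distrib]
      map_smul' := fun c h => by
        simp only [LinearMap.smul_apply, map_smul, Finset.smul_sum, RingHom.id_apply] }
  let c : M →ₗ[Cᵐᵒᵖ] RD k Q0 := RDform (fun m x => p (r (evStar m x)))
    (fun m m' x => by
      rw [← map_add, ← map_add]; congr 2; ext f; simp [evStar])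
    (fun m x x' => by
      rw [← map_add, ← map_add]; congr 2; ext f; simp [evStar, add_smul])
    (fun a m x => by
      rw [← smul_eq_mul, ← map_smul, ← map_smul]; congr 2; ext f
      simp [evStar, LinearMap.map_smul_of_tower])
    (fun a m x => by
      congr 2; ext f; simp [evStar, mul_smul])
  refine ⟨c, ?_⟩
  ext m x
  show p (r (evStar m (d x))) = b m x
  have : evStar m (d x) = T (evStar m x) := rfl
  rw [this, hr']
  show ∑ i, b (op (s i x) • m) (q i) = b m x
  conv_rhs => rw [← hq x, map_sum]
  refine Finset.sum_congr rfl fun i _ => ?_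
  rw [map_smul, RD.smul_apply]; rfl

lemma homzero_of_lift [Module.Finite C Q1] [Module.Projective C Q1]
    [Module.Finite C Q0] [Module.Projective C Q0]
    (d : Q1 →ₗ[C] Q0)
    (H : ∀ b : M →ₗ[Cᵐᵒᵖ] RD k Q1, ∃ c : M →ₗ[Cᵐᵒᵖ] RD k Q0, (RDmap d).comp c = b)
    (h : (Q1 →ₗ[C] C) →ₗ[Cᵐᵒᵖ] M) (hh : h.comp (preStar d) = 0) : h = 0 := by
  let _ : Module k M := Module.restrictScalars k Cᵐᵒᵖ M
  have : IsScalarTower k Cᵐᵒᵖ M := IsScalarTower.restrictScalars k Cᵐᵒᵖ M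
  obtain ⟨n, q, s, hq⟩ := exists_dual_basis (R := C) Q1
  obtain ⟨n', q', s', hq'⟩ := exists_dual_basis (R := C) Q0
  ext f
  rw [LinearMap.zero_apply]
  rw [← Module.forall_dual_apply_eq_zero_iff k]
  intro l
  obtain ⟨c, hc⟩ := H (RDs l f)
  have hc' : ∀ m x, c m (d x) = l (op (f x) • m) := fun m x => by
    rw [← RDs_apply, ← hc]; rfl
  have h1 : l (h f) = ∑ i, c (h (s i)) (d (q i)) := by
    conv_lhs => rw [← star_expand q s hq f]
    rw [map_sum, map_sum]
    refine Finset.sum_congr rfl fun i _ => ?_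
    rw [hc', map_smul]
  have h2 : ∀ i, c (h (s i)) (d (q i)) =
      ∑ j, RDeval c (q' j) (h (op (s' j (d (q i))) • s i)) := by
    intro i
    conv_lhs => rw [← hq' (d (q i)), map_sum]
    refine Finset.sum_congr rfl fun j _ => ?_
    rw [RDeval_apply, h.map_smul, c.map_smul, RD.smul_apply, unop_op]
  rw [h1, Finset.sum_congr rfl (fun i _ => h2 i), Finset.sum_comm]
  refine Finset.sum_eq_zero fun j _ => ?_
  rw [← map_sum, ← map_sum]
  have h3 := star_expand q s hq ((s' j).comp d)
  simp only [LinearMap.comp_apply] at h3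
  rw [h3]
  have h4 : h ((s' j).comp d) = 0 := LinearMap.congr_fun hh (s' j)
  rw [h4, map_zero]

end

end DualModules

section Dual2

variable {k : Type} [Field k] {C : Type} [Ring C] [Algebra k C]

noncomputable instance (Q : Type) [AddCommGroup Q] [Module k Q] : Module k (RD k Q) :=
  inferInstanceAs (Module k (Q →ₗ[k] k))

instance (Q : Type) [AddCommGroup Q] [Module k Q] [Module C Q] [IsScalarTower k C Q] :
    IsScalarTower k Cᵐᵒᵖ (RD k Q) := by
  refine ⟨fun c a f => ?_⟩
  ext x
  show f ((c • unop a) • x) = c • f (unop a • x)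
  rw [smul_assoc, map_smul]

lemma RD_finite (Q : Type) [AddCommGroup Q] [Module k Q] [Module C Q] [IsScalarTower k C Q]
    [Module.Finite k Q] : Module.Finite Cᵐᵒᵖ (RD k Q) := by
  have : Module.Finite k (RD k Q) := inferInstanceAs (Module.Finite k (Q →ₗ[k] k))
  exact Module.Finite.of_restrictScalars_finite k Cᵐᵒᵖ (RD k Q)

section
variable {Y Q Z : Type} [AddCommGroup Y] [Module k Y] [Module C Y] [IsScalarTower k C Y]
  [AddCommGroup Q] [Module k Q] [Module C Q] [IsScalarTower k C Q]
  [AddCommGroup Z] [Module k Z] [Module C Z] [IsScalarTower k C Z]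

lemma RDmap_injective (p : Q →ₗ[C] Z) (hp : Function.Surjective p) :
    Function.Injective (RDmap (k := k) p) := by
  intro f g h
  ext z
  obtain ⟨x, rfl⟩ := hp z
  exact congrArg (fun (t : RD k Q) => t x) h

lemma RDmap_surjective (i : Y →ₗ[C] Q) (hi : Function.Injective i) :
    Function.Surjective (RDmap (k := k) i) := by
  intro f
  obtain ⟨r, hr⟩ := LinearMap.exists_leftInverse_of_injective (i.restrictScalars k)
    (LinearMap.ker_eq_bot.2 hi)
  refine ⟨LinearMap.comp (M₃ := k) (R₃ := k) f r, ?_⟩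
  ext x
  show f (r (i x)) = f x
  exact congrArg f (LinearMap.congr_fun hr x)

lemma RDmap_exact (i : Y →ₗ[C] Q) (p : Q →ₗ[C] Z) (hp : Function.Surjective p)
    (h : LinearMap.range i = LinearMap.ker p) :
    LinearMap.range (RDmap (k := k) p) = LinearMap.ker (RDmap (k := k) i) := by
  apply le_antisymm
  · rintro _ ⟨f, rfl⟩
    rw [LinearMap.mem_ker]
    ext x
    show f (p (i x)) = 0
    have : p (i x) = 0 := by
      rw [← LinearMap.mem_ker, ← h]; exact LinearMap.mem_range_self i x
    rw [this, map_zero]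
  · intro f hf
    rw [LinearMap.mem_ker] at hf
    let f' : Q →ₗ[k] k := f
    have hk : LinearMap.ker (p.restrictScalars k) ≤ LinearMap.ker f' := by
      intro x hx
      have hx' : x ∈ LinearMap.range i := by rw [h]; exact hx
      obtain ⟨y, rfl⟩ := hx'
      exact congrArg (fun (t : RD k Y) => t y) hf
    let e := (p.restrictScalars k).quotKerEquivOfSurjective hp
    refine ⟨((LinearMap.ker (p.restrictScalars k)).liftQ f' hk).comp e.symm.toLinearMap, ?_⟩
    ext x
    show (LinearMap.ker (p.restrictScalars k)).liftQ f' hk (e.symm (p x)) = f x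
    have h1 : e.symm (p x) = Submodule.Quotient.mk x := by
      rw [LinearEquiv.symm_apply_eq]; rfl
    rw [h1]; rfl

lemma section_of_retraction [Module.Finite k Q] (p : Q →ₗ[C] Z)
    (r : RD k Q →ₗ[Cᵐᵒᵖ] RD k Z) (hr : ∀ f, r (RDmap p f) = f) :
    ∃ s : Z →ₗ[C] Q, p.comp s = LinearMap.id := by
  have sep : ∀ {T : Type} [AddCommGroup T] [Module k T] (x y : T),
      (∀ f : RD k T, f x = f y) → x = y := by
    intro T _ _ x y h
    rw [← sub_eq_zero, ← Module.forall_dual_apply_eq_zero_iff k]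
    intro f
    rw [map_sub, sub_eq_zero]
    exact h f
  have ex : ∀ z : Z, ∃ x : Q, ∀ f : RD k Q, f x = r f z := by
    intro z
    let F : Module.Dual k (Module.Dual k Q) :=
      { toFun := fun f => r f z
        map_add' := fun f g => by
          have : r ((f + g : Module.Dual k Q)) = r f + r g := r.map_add f g
          rw [this]; rfl
        map_smul' := fun c f => by
          have : (c • (show RD k Q from f)) = (c • (1 : Cᵐᵒᵖ)) • (show RD k Q from f) := by
            rw [smul_assoc, one_smul]
          have h2 : r (c • (show RD k Q from f)) = c • r f := by
            rw [this, r.map_smul, smul_assoc, one_smul]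
          exact congrArg (fun (t : RD k Z) => t z) h2 }
    refine ⟨(Module.evalEquiv k Q).symm F, fun f => ?_⟩
    exact Module.apply_evalEquiv_symm_apply k Q f F
  choose s hs using ex
  refine ⟨{ toFun := s, map_add' := fun x y => ?_, map_smul' := fun a x => ?_ }, ?_⟩
  · apply sep
    intro f
    rw [map_add, hs, hs, hs, map_add]
  · apply sep
    intro f
    have := hs x (op a • f)
    rw [RD.smul_apply, r.map_smul, RD.smul_apply] at this
    rw [hs]
    exact this.symm
  · ext z
    show p (s z) = z
    apply sep
    intro f
    have := hs z (RDmap p f)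
    rw [hr] at this
    exact this
end

lemma finite_of_superfluous {R P M : Type} [Ring R] [AddCommGroup P] [AddCommGroup M]
    [Module R P] [Module R M] (f : P →ₗ[R] M) [hfin : Module.Finite R (LinearMap.range f)]
    (h : ∀ N : Submodule R P, N ⊔ LinearMap.ker f = ⊤ → N = ⊤) : Module.Finite R P := by
  obtain ⟨n, g, hg⟩ := Module.Finite.exists_fin (R := R) (M := LinearMap.range f)
  have hl : ∀ i, ∃ x, f x = g i := fun i => (g i).2
  choose x hx using hl
  have hN : Submodule.span R (Set.range x) = ⊤ := by
    apply h
    rw [eq_top_iff]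
    intro y _
    have h1 : (⟨f y, LinearMap.mem_range_self f y⟩ : LinearMap.range f) ∈
        Submodule.span R (Set.range g) := by rw [hg]; trivial
    have h2 := Submodule.mem_map_of_mem (f := (LinearMap.range f).subtype) h1
    rw [Submodule.map_span, ← Set.range_comp] at h2
    have h3 : (⇑(LinearMap.range f).subtype ∘ g) = ⇑f ∘ x := by
      funext i; exact (hx i).symm
    rw [h3, Set.range_comp, ← Submodule.map_span] at h2
    obtain ⟨z, hz, hzy⟩ := h2
    rw [Submodule.mem_sup]
    refine ⟨z, hz, y - z, ?_, by abel⟩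
    rw [LinearMap.mem_ker, map_sub, hzy]
    simp
  exact ⟨⟨(Set.finite_range x).toFinset, by simpa using hN⟩⟩

lemma finite_injEnv [FiniteDimensional k C] {I : Mdl Cᵐᵒᵖ}
    (f : ModuleCat.of Cᵐᵒᵖ C →ₗ[Cᵐᵒᵖ] I) (hf : IsInjEnv Cᵐᵒᵖ f) : Module.Finite Cᵐᵒᵖ I := by
  have : IsNoetherianRing Cᵐᵒᵖ := isNoetherian_of_tower k inferInstance
  obtain ⟨-, hinj, hess⟩ := hf
  let b := Module.finBasis k C
  let g : C →ₗ[Cᵐᵒᵖ] (Fin (Module.finrank k C) → RD k C) :=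
    LinearMap.pi fun i => RDs (C := C) (Q := C) (b.coord i) LinearMap.id
  have hg : Function.Injective g := by
    rw [injective_iff_map_eq_zero]
    intro c hc
    apply b.ext_elem
    intro i
    have h1 : RDs (C := C) (Q := C) (b.coord i) LinearMap.id c = 0 := congrFun hc i
    have h2 := congrArg (fun (t : RD k C) => t (1 : C)) h1
    simpa [RDs_apply, RD.zero_apply] using h2
  have hE : Module.Injective Cᵐᵒᵖ (Fin (Module.finrank k C) → RD k C) := by
    have : Module.Injective Cᵐᵒᵖ (RD k C) := RD_injective (C := C)
    infer_instance
  have : Module.Finite Cᵐᵒᵖ (RD k C) := RD_finite C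
  obtain ⟨h, hh⟩ := hE.out f hinj g
  have hker : LinearMap.ker h = ⊥ := by
    apply hess
    rw [eq_bot_iff]
    rintro _ ⟨hx, ⟨c, rfl⟩⟩
    have : g c = 0 := by rw [← hh]; exact hx
    have hc : c = 0 := (injective_iff_map_eq_zero g).1 hg c this
    rw [hc, map_zero]; exact Submodule.zero_mem _
  exact Module.Finite.of_injective h (LinearMap.ker_eq_bot.1 hker)

lemma dual_equiv [FiniteDimensional k C] {V : Mdl Cᵐᵒᵖ} {N : Mdl C} [Module.Finite Cᵐᵒᵖ V]
    [Module k N] [IsScalarTower k C N] (h : IskDual k C V N) :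
    Module.Finite k N ∧ Nonempty (V ≃ₗ[Cᵐᵒᵖ] RD k N) := by
  obtain ⟨φ, h1, h2, h3, h4, h5, h6⟩ := h
  let _ : Module k V := Module.restrictScalars k Cᵐᵒᵖ V
  have : IsScalarTower k Cᵐᵒᵖ V := IsScalarTower.restrictScalars k Cᵐᵒᵖ V
  have : Module.Finite k V := Module.Finite.trans Cᵐᵒᵖ V
  let F : V →ₗ[Cᵐᵒᵖ] RD k N := RDform φ h1 h2
    (fun c m q => by rw [← h3, algebraMap_smul]) h4
  have hF : Function.Injective F := by
    rw [injective_iff_map_eq_zero]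
    intro v hv
    exact h5 v fun m => congrArg (fun (t : RD k N) => t m) hv
  let G : N →ₗ[k] Module.Dual k V :=
    { toFun := fun n => RDeval F n
      map_add' := fun x y => by ext v; exact h2 v x y
      map_smul' := fun c x => by ext v; exact map_smul (F v) c x }
  have hG : Function.Injective G := by
    rw [injective_iff_map_eq_zero]
    intro n hn
    exact h6 n fun v => LinearMap.congr_fun hn v
  have hN : Module.Finite k N := Module.Finite.of_injective G hG
  refine ⟨hN, ⟨LinearEquiv.ofBijective F ⟨hF, ?_⟩⟩⟩
  have hfin : Module.Finite k (RD k N) := inferInstanceAs (Module.Finite k (N →ₗ[k] k))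
  have e1 : Module.finrank k N ≤ Module.finrank k V := by
    rw [← Subspace.dual_finrank_eq (V := V)]
    exact LinearMap.finrank_le_finrank_of_injective hG
  have e2 : Module.finrank k (RD k N) = Module.finrank k N :=
    Subspace.dual_finrank_eq (K := k) (V := N)
  have e3 : Module.finrank k V ≤ Module.finrank k (RD k N) :=
    LinearMap.finrank_le_finrank_of_injective (f := F.restrictScalars k) hF
  exact (LinearMap.injective_iff_surjective_of_finrank_eq_finrank (f := F.restrictScalars k)
    (by omega)).1 hF

end Dual2

/-- For an algebra `C` of global dimension exactly 2 and a module `M`,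
`pd_C M ≤ 1` iff `Hom_C(τ⁻¹ Ω⁻¹ C, M) = 0`. -/
theorem pd_le_one_iff_hom_vanish
    (k : Type) [Field k] (C : Type) [Ring C] [Algebra k C] [FiniteDimensional k C]
    (hgl : GlDimEq2 Cᵐᵒᵖ)
    (M : Mdl Cᵐᵒᵖ) [Module.Finite Cᵐᵒᵖ M]
    (W : Mdl Cᵐᵒᵖ) (hW : IsTauInvCosyz k C (ModuleCat.of Cᵐᵒᵖ C) W) :
    PdLE1 Cᵐᵒᵖ M ↔ HomZero Cᵐᵒᵖ W M := by
  have hNr : IsNoetherianRing Cᵐᵒᵖ := isNoetherian_of_tower k inferInstance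
  have hNl : IsNoetherianRing C := isNoetherian_of_tower k inferInstance
  obtain ⟨V, ⟨I, f, hf, ⟨eV⟩⟩, N, hN, Q1, Q0, d1, d0, ⟨⟨hP0, hs0, hm0⟩, hP1, hex, hm1⟩,
    q, hq, hqk⟩ := hW
  have hI : Module.Finite Cᵐᵒᵖ I := finite_injEnv (k := k) f hf
  have hVf : Module.Finite Cᵐᵒᵖ V := Module.Finite.equiv eV.symm
  let _ : Module k N := Module.restrictScalars k C N
  have : IsScalarTower k C N := IsScalarTower.restrictScalars k C N
  let _ : Module k Q1 := Module.restrictScalars k C Q1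
  have : IsScalarTower k C Q1 := IsScalarTower.restrictScalars k C Q1
  let _ : Module k Q0 := Module.restrictScalars k C Q0
  have : IsScalarTower k C Q0 := IsScalarTower.restrictScalars k C Q0
  obtain ⟨hNf, ⟨e⟩⟩ := dual_equiv hN
  have hNC : Module.Finite C N := Module.Finite.of_restrictScalars_finite k C N
  have hQ0 : Module.Finite C Q0 := finite_of_superfluous d0 hm0
  have hQ1 : Module.Finite C Q1 := finite_of_superfluous d1 hm1
  have hQ1k : Module.Finite k Q1 := Module.Finite.trans C Q1
  have hI0 : Module.Injective Cᵐᵒᵖ (RD k Q0) := RD_injective (C := C)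
  -- the sequence `0 → C → I → V → 0`
  let π : I →ₗ[Cᵐᵒᵖ] V := eV.symm.toLinearMap.comp (LinearMap.range f).mkQ
  have hπ : Function.Surjective π :=
    eV.symm.surjective.comp (Submodule.mkQ_surjective _)
  have hfπ : LinearMap.range f = LinearMap.ker π := by
    simp [π, LinearEquiv.ker_comp]
  -- the map `V → D Q0`
  let j : V →ₗ[Cᵐᵒᵖ] ModuleCat.of Cᵐᵒᵖ (RD k Q0) := (RDmap d0).comp e.toLinearMap
  have hj : Function.Injective j := (RDmap_injective d0 hs0).comp e.injective
  have hjr : LinearMap.range j = LinearMap.range (RDmap (k := k) d0) := by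
    simp only [j]
    exact LinearMap.range_comp_of_range_eq_top _ e.range
  -- injective dimensions
  have hpd : ∀ X : Mdl Cᵐᵒᵖ, HasProjectiveDimensionLT X 3 := fun X => pdlt_three (hgl.1 X)
  have hid : HasInjectiveDimensionLT (ModuleCat.of Cᵐᵒᵖ C) 3 := by
    refine HasInjectiveDimensionLT.mk.{0} fun i hi Y x => ?_
    have := hpd Y
    exact Abelian.Ext.eq_zero_of_hasProjectiveDimensionLT x 3 hi
  rw [idlt_of_ses f π hf.2.1 hπ hfπ hf.1 1] at hid
  -- `d1` is injective
  let Y := LinearMap.range d1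
  have hY : Module.Injective Cᵐᵒᵖ (RD k Y) := by
    let g : ModuleCat.of Cᵐᵒᵖ (RD k Q0) →ₗ[Cᵐᵒᵖ] ModuleCat.of Cᵐᵒᵖ (RD k Y) := RDmap Y.subtype
    rw [idlt_of_ses j g hj (RDmap_surjective Y.subtype Subtype.val_injective)
      (hjr.trans (RDmap_exact Y.subtype d0 hs0 (by rw [Submodule.range_subtype]; exact hex)))
      hI0 0] at hid
    exact (Module.injective_iff_injective_object Cᵐᵒᵖ (RD k Y)).2
      (injective_iff_hasInjectiveDimensionLT_one.2 hid)
  have hd1 : Function.Injective d1 := by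
    let p : Q1 →ₗ[C] Y := d1.rangeRestrict
    have hp : Function.Surjective p := d1.surjective_rangeRestrict
    obtain ⟨r, hr⟩ := hY.out (RDmap (k := k) p) (RDmap_injective p hp) LinearMap.id
    obtain ⟨s, hs⟩ := section_of_retraction p r hr
    have hs' : ∀ y, p (s y) = y := fun y => LinearMap.congr_fun hs y
    have htop : LinearMap.range s = ⊤ := by
      apply hm1
      rw [eq_top_iff]
      intro x _
      rw [Submodule.mem_sup]
      refine ⟨s (p x), LinearMap.mem_range_self s _, x - s (p x), ?_, by abel⟩
      have h1 : p (x - s (p x)) = 0 := by rw [map_sub, hs', sub_self]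
      exact congrArg Subtype.val h1
    rw [LinearMap.range_eq_top] at htop
    intro x x' hxx
    obtain ⟨y, rfl⟩ := htop x
    obtain ⟨y', rfl⟩ := htop x'
    have : p (s y) = p (s y') := Subtype.ext hxx
    rw [hs', hs'] at this
    rw [this]
  -- the key equivalence
  let g1 : ModuleCat.of Cᵐᵒᵖ (RD k Q0) →ₗ[Cᵐᵒᵖ] ModuleCat.of Cᵐᵒᵖ (RD k Q1) := RDmap d1
  have key := ext_one_iff_lift j g1 hj (RDmap_surjective d1 hd1)
      (hjr.trans (RDmap_exact d1 d0 hs0 hex)) hI0 M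
  have shift := ext_shift_inj f π hf.2.1 hπ hfπ hf.1 M
  have hom : HomZero Cᵐᵒᵖ W M ↔
      ∀ h : (Q1 →ₗ[C] C) →ₗ[Cᵐᵒᵖ] M, h.comp (preStar d1) = 0 → h = 0 := by
    constructor
    · intro H h hh
      have hk : LinearMap.ker q ≤ LinearMap.ker h := by
        intro g hg
        obtain ⟨t, rfl⟩ := (hqk g).1 hg
        exact LinearMap.congr_fun hh t
      let eq := q.quotKerEquivOfSurjective hq
      have h0 := H (((LinearMap.ker q).liftQ h hk).comp eq.symm.toLinearMap)
      ext1 g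
      have h1 : eq.symm (q g) = Submodule.Quotient.mk g := by
        rw [LinearEquiv.symm_apply_eq]; rfl
      have h2 := LinearMap.congr_fun h0 (q g)
      simp only [LinearMap.comp_apply, LinearEquiv.coe_coe, h1] at h2
      exact h2
    · intro H t
      have h0 := H (t.comp q) (by
        ext1 g
        have : q (g.comp d1) = 0 := (hqk _).2 ⟨g, rfl⟩
        show t (q (g.comp d1)) = 0
        rw [this, map_zero])
      ext1 w
      obtain ⟨g, rfl⟩ := hq w
      exact LinearMap.congr_fun h0 g
  rw [hom]
  constructor
  · intro hM
    have h2 := pdlt_two hM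
    have hsub : Subsingleton (Abelian.Ext.{0} M (ModuleCat.of Cᵐᵒᵖ C) 2) :=
      HasProjectiveDimensionLT.subsingleton.{0} M 2 2 le_rfl _
    exact homzero_of_lift (k := k) d1 (key.1 (shift.1 hsub))
  · intro H
    have hsub := shift.2 (key.2 (fun b => lift_of_homzero (k := k) d1 H b))
    let ec : C ≃ₗ[Cᵐᵒᵖ] Cᵐᵒᵖ :=
      { toFun := op
        invFun := unop
        left_inv := fun _ => rfl
        right_inv := fun _ => rfl
        map_add' := fun _ _ => rfl
        map_smul' := fun _ _ => rfl }
    exact pdle1_of_ext M (hpd M) (ModuleCat.of Cᵐᵒᵖ C) ec hsub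
end

section
/- Let B be a split extension of an algebra C by a nilpotent bimodule E. Then for every finitely generated C-module M there are short exact sequences of B-modules 0 → M ⊗_C E → M ⊗_C B → M → 0 and 0 → M → D(B ⊗_C DM) → D(E ⊗_C DM) → 0. -/
open CategoryTheory MulOpposite

open CategoryTheory MulOpposite

section SplitExt

variable {B C : Type} [Ring B] [Ring C]

/-- a right `C`-module viewed as a right `B`-module via a ring hom `π : B → C`. -/
def modAlong (π : B →+* C) (M : Mdl Cᵐᵒᵖ) : Mdl Bᵐᵒᵖ :=
  letI : Module Bᵐᵒᵖ M := Module.compHom M (RingHom.op π)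
  ModuleCat.of _ M

/-- `X` is the induced module `M ⊗_C B` along `σ : C → B`, characterized by the
universal property of induction (extension of scalars). -/
def IsInducedAlong (σ : C →+* B) (M : Mdl Cᵐᵒᵖ) (X : Mdl Bᵐᵒᵖ) : Prop :=
  ∃ φ : M →+ X,
    (∀ (c : C) (m : M), φ (op c • m) = op (σ c) • φ m) ∧
    ∀ (Y : Mdl Bᵐᵒᵖ) (ψ : M →+ Y),
      (∀ (c : C) (m : M), ψ (op c • m) = op (σ c) • ψ m) →
      ∃! h : X →ₗ[Bᵐᵒᵖ] Y, ∀ m, h (φ m) = ψ m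

/-- `X` is the coinduced module `D(B ⊗_C D M) ≅ Hom_C(B, M)` along `σ : C → B`,
characterized by the universal property of coinduction. -/
def IsCoinducedAlong (σ : C →+* B) (M : Mdl Cᵐᵒᵖ) (X : Mdl Bᵐᵒᵖ) : Prop :=
  ∃ p : X →+ M,
    (∀ (c : C) (x : X), p (op (σ c) • x) = op c • p x) ∧
    ∀ (Y : Mdl Bᵐᵒᵖ) (ψ : Y →+ M),
      (∀ (c : C) (y : Y), ψ (op (σ c) • y) = op c • ψ y) →
      ∃! h : Y →ₗ[Bᵐᵒᵖ] X, ∀ y, p (h y) = ψ y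

end SplitExt

section TrivExt

variable (C : Type) [Ring C] (E : Type) [AddCommGroup E]
  [Module C E] [Module Cᵐᵒᵖ E] [SMulCommClass C Cᵐᵒᵖ E]

/-- the projection `B = C ⋉ E → C` as a ring hom. -/
def tszeFst : TrivSqZeroExt C E →+* C where
  toFun := TrivSqZeroExt.fst
  map_one' := rfl
  map_mul' _ _ := rfl
  map_zero' := rfl
  map_add' _ _ := rfl

/-- the inclusion `σ : C → B = C ⋉ E` as a ring hom. -/
def tszeInl : C →+* TrivSqZeroExt C E where
  toFun := TrivSqZeroExt.inl
  map_one' := rfl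
  map_mul' x y := TrivSqZeroExt.inl_mul (M := E) x y
  map_zero' := TrivSqZeroExt.inl_zero (M := E)
  map_add' x y := TrivSqZeroExt.inl_add (M := E) x y

/-- a right `C`-module viewed as a module over the trivial extension `C ⋉ E`. -/
def modB (M : Mdl Cᵐᵒᵖ) : Mdl (TrivSqZeroExt C E)ᵐᵒᵖ :=
  modAlong (tszeFst C E) M

/-- `X = M ⊗_C B` for `B = C ⋉ E`. -/
def IsInduced (M : Mdl Cᵐᵒᵖ) (X : Mdl (TrivSqZeroExt C E)ᵐᵒᵖ) : Prop :=
  IsInducedAlong (tszeInl C E) M X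

/-- `X = D(B ⊗_C D M)` for `B = C ⋉ E`. -/
def IsCoinduced (M : Mdl Cᵐᵒᵖ) (X : Mdl (TrivSqZeroExt C E)ᵐᵒᵖ) : Prop :=
  IsCoinducedAlong (tszeInl C E) M X

end TrivExt

section RelExt

variable (k : Type) [Field k] (C : Type) [Ring C] [Algebra k C]
  (E : Type) [AddCommGroup E] [Module C E] [Module Cᵐᵒᵖ E]

/-- The `C`-`C`-bimodule `E` is `Ext²_C(DC, C)`: there is a projective
resolution `0 → P2 → P1 → P0 → DC → 0` of the right module `DC = Hom_k(C,k)`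
(characterized by a nondegenerate balanced pairing `φ` with `C`), and `E` is
the cokernel of `Hom_C(P1, C) → Hom_C(P2, C)` as a left `C`-module, with the
right `C`-action on `E` induced (contravariantly, via lifts of the left action
on `DC`) by functoriality of `Ext²(-, C)`. -/
def IsRelExt : Prop :=
  ∃ (DC : Mdl Cᵐᵒᵖ) (φ : DC → C → k),
    (∀ n n' m, φ (n + n') m = φ n m + φ n' m) ∧
    (∀ n m m', φ n (m + m') = φ n m + φ n m') ∧
    (∀ (c : k) n m, φ n ((algebraMap k C c) * m) = c * φ n m) ∧
    (∀ (a : C) n m, φ (op a • n) m = φ n (a * m)) ∧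
    (∀ n, (∀ m, φ n m = 0) → n = 0) ∧
    (∀ m, (∀ n, φ n m = 0) → m = 0) ∧
    ∃ (P2 P1 P0 : Mdl Cᵐᵒᵖ) (d2 : P2 →ₗ[Cᵐᵒᵖ] P1) (d1 : P1 →ₗ[Cᵐᵒᵖ] P0)
      (d0 : P0 →ₗ[Cᵐᵒᵖ] DC),
      Module.Projective Cᵐᵒᵖ P2 ∧ Module.Projective Cᵐᵒᵖ P1 ∧
      Module.Projective Cᵐᵒᵖ P0 ∧
      Function.Injective d2 ∧ Function.Surjective d0 ∧
      LinearMap.range d2 = LinearMap.ker d1 ∧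
      LinearMap.range d1 = LinearMap.ker d0 ∧
      ∃ q : (P2 →ₗ[Cᵐᵒᵖ] C) →ₗ[C] E,
        Function.Surjective q ∧
        (∀ g : P2 →ₗ[Cᵐᵒᵖ] C, q g = 0 ↔ ∃ f : P1 →ₗ[Cᵐᵒᵖ] C, g = f.comp d2) ∧
        ∀ c : C, ∃ (μ : DC →ₗ[Cᵐᵒᵖ] DC) (f0 : P0 →ₗ[Cᵐᵒᵖ] P0)
            (f1 : P1 →ₗ[Cᵐᵒᵖ] P1) (f2 : P2 →ₗ[Cᵐᵒᵖ] P2),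
          (∀ n x, φ (μ n) x = φ n (x * c)) ∧
          d0.comp f0 = μ.comp d0 ∧
          d1.comp f1 = f0.comp d1 ∧
          d2.comp f2 = f1.comp d2 ∧
          ∀ g : P2 →ₗ[Cᵐᵒᵖ] C, q (g.comp f2) = op c • q g

end RelExt


section KernelTensor

variable {B C : Type} [Ring B] [Ring C]

/-- left action of `C` (via `σ`) on the kernel ideal `E = ker π`. -/
def kInl (π : B →+* C) (σ : C →+* B) (c : C) (e : RingHom.ker π) :
    RingHom.ker π :=
  ⟨σ c * e.1, by
    have h : π e.1 = 0 := RingHom.mem_ker.mp e.2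
    exact RingHom.mem_ker.mpr (by rw [map_mul, h, mul_zero])⟩

/-- right action of `B` on the kernel ideal `E = ker π`. -/
def kRight (π : B →+* C) (e : RingHom.ker π) (b : B) : RingHom.ker π :=
  ⟨e.1 * b, by
    have h : π e.1 = 0 := RingHom.mem_ker.mp e.2
    exact RingHom.mem_ker.mpr (by rw [map_mul, h, zero_mul])⟩

/-- left action of `B` on the kernel ideal `E = ker π`. -/
def kLeft (π : B →+* C) (b : B) (e : RingHom.ker π) : RingHom.ker π :=
  ⟨b * e.1, by
    have h : π e.1 = 0 := RingHom.mem_ker.mp e.2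
    exact RingHom.mem_ker.mpr (by rw [map_mul, h, mul_zero])⟩

/-- `T` is the tensor product `M ⊗_C E` (for `E = ker π`) as a right
`B`-module, characterized by the universal property of the balanced product. -/
def IsTensorKer (π : B →+* C) (σ : C →+* B)
    (M : Mdl Cᵐᵒᵖ) (T : Mdl Bᵐᵒᵖ) : Prop :=
  ∃ β : M → RingHom.ker π → T,
    (∀ m m' e, β (m + m') e = β m e + β m' e) ∧
    (∀ m e e', β m (e + e') = β m e + β m e') ∧
    (∀ (b : B) m e, β m (kRight π e b) = op b • β m e) ∧
    (∀ (c : C) m e, β (op c • m) e = β m (kInl π σ c e)) ∧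
    ∀ (Z : Mdl Bᵐᵒᵖ) (γ : M → RingHom.ker π → Z),
      (∀ m m' e, γ (m + m') e = γ m e + γ m' e) →
      (∀ m e e', γ m (e + e') = γ m e + γ m e') →
      (∀ (b : B) m e, γ m (kRight π e b) = op b • γ m e) →
      (∀ (c : C) m e, γ (op c • m) e = γ m (kInl π σ c e)) →
      ∃! h : T →ₗ[Bᵐᵒᵖ] Z, ∀ m e, h (β m e) = γ m e

/-- `T` is `Hom_C(E, M) ≅ D(E ⊗_C D M)` (for `E = ker π`) as a right
`B`-module, characterized by the universal property of the evaluation pairing. -/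
def IsHomKer (π : B →+* C) (σ : C →+* B)
    (M : Mdl Cᵐᵒᵖ) (T : Mdl Bᵐᵒᵖ) : Prop :=
  ∃ ε : T → RingHom.ker π → M,
    (∀ t t' e, ε (t + t') e = ε t e + ε t' e) ∧
    (∀ t e e', ε t (e + e') = ε t e + ε t e') ∧
    (∀ (b : B) t e, ε (op b • t) e = ε t (kLeft π b e)) ∧
    (∀ (c : C) t e, ε t (kRight π e (σ c)) = op c • ε t e) ∧
    ∀ (Z : Mdl Bᵐᵒᵖ) (δ : Z → RingHom.ker π → M),
      (∀ z z' e, δ (z + z') e = δ z e + δ z' e) →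
      (∀ z e e', δ z (e + e') = δ z e + δ z e') →
      (∀ (b : B) z e, δ (op b • z) e = δ z (kLeft π b e)) →
      (∀ (c : C) z e, δ z (kRight π e (σ c)) = op c • δ z e) →
      ∃! h : Z →ₗ[Bᵐᵒᵖ] T, ∀ z e, ε (h z) e = δ z e

end KernelTensor


section SplitExtProof

variable {B C : Type} [Ring B] [Ring C]

/-- the kernel component of `b`. -/
def kPart (π : B →+* C) (σ : C →+* B) (hs : ∀ c, π (σ c) = c) (b : B) : RingHom.ker π :=
  ⟨b - σ (π b), RingHom.mem_ker.mpr (by rw [map_sub, hs, sub_self])⟩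

/-- right `B`-module structure on the kernel. -/
@[reducible] def kerModule (π : B →+* C) : Module Bᵐᵒᵖ (RingHom.ker π) where
  smul b e := kRight π e b.unop
  one_smul e := Subtype.ext (mul_one e.1)
  mul_smul a b e := Subtype.ext (mul_assoc e.1 b.unop a.unop).symm
  smul_zero a := Subtype.ext (zero_mul a.unop)
  smul_add a e e' := Subtype.ext (add_mul e.1 e'.1 a.unop)
  add_smul a b e := Subtype.ext (mul_add e.1 a.unop b.unop)
  zero_smul e := Subtype.ext (mul_zero e.1)

open TensorProduct in
theorem exists_tensorKer (π : B →+* C) (σ : C →+* B) (M : Mdl Cᵐᵒᵖ) :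
    ∃ T : Mdl Bᵐᵒᵖ, IsTensorKer π σ M T := by
  let _ := kerModule π
  let R : Submodule Bᵐᵒᵖ ((RingHom.ker π) ⊗[ℤ] M) :=
    Submodule.span Bᵐᵒᵖ {x | ∃ (c : C) (m : M) (e : RingHom.ker π),
      x = e ⊗ₜ[ℤ] (op c • m) - (kInl π σ c e) ⊗ₜ[ℤ] m}
  refine ⟨ModuleCat.of _ (((RingHom.ker π) ⊗[ℤ] M) ⧸ R),
    fun m e => R.mkQ (e ⊗ₜ[ℤ] m), ?_, ?_, ?_, ?_, ?_⟩
  · intro m m' e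
    exact (congrArg R.mkQ (TensorProduct.tmul_add e m m')).trans (map_add R.mkQ _ _)
  · intro m e e'
    exact (congrArg R.mkQ (TensorProduct.add_tmul e e' m)).trans (map_add R.mkQ _ _)
  · intro b m e
    exact (R.mkQ).map_smul (op b) (e ⊗ₜ[ℤ] m)
  · intro c m e
    rw [← sub_eq_zero, ← map_sub]
    exact (Submodule.Quotient.mk_eq_zero R).2 (Submodule.subset_span ⟨c, m, e, rfl⟩)
  · intro Z γ h1 h2 h3 h4
    let g : (RingHom.ker π) →+ M →+ Z :=
      AddMonoidHom.mk' (fun e => AddMonoidHom.mk' (fun m => γ m e) (fun m m' => h1 m m' e))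
        (fun e e' => AddMonoidHom.ext fun m => h2 m e e')
    let G0 : (RingHom.ker π) ⊗[ℤ] M →+ Z := TensorProduct.liftAddHom g (by
      intro r e m
      rw [map_zsmul, map_zsmul]; rfl)
    let G : (RingHom.ker π) ⊗[ℤ] M →ₗ[Bᵐᵒᵖ] Z :=
      { G0 with
        map_smul' := by
          intro b x
          change G0 (b • x) = b • G0 x
          induction x using TensorProduct.induction_on with
          | zero => rw [smul_zero, map_zero, smul_zero]
          | tmul e m => exact h3 b.unop m e
          | add x y hx hy => rw [smul_add, map_add, hx, hy, map_add, smul_add] }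
    have hG : ∀ e m, G (e ⊗ₜ[ℤ] m) = γ m e := fun e m => rfl
    have hR : R ≤ LinearMap.ker G := by
      refine Submodule.span_le.2 ?_
      rintro _ ⟨c, m, e, rfl⟩
      change G _ = 0
      rw [map_sub, hG, hG, h4, sub_self]
    refine ⟨R.liftQ G hR, fun m e => hG e m, ?_⟩
    intro h hh
    refine LinearMap.ext fun x => ?_
    obtain ⟨y, rfl⟩ := R.mkQ_surjective x
    change h _ = G y
    induction y using TensorProduct.induction_on with
    | zero => rw [map_zero, map_zero, map_zero]
    | tmul e m => exact hh m e
    | add x y hx hy => rw [map_add, map_add, hx, hy, map_add]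

theorem first_sequence (π : B →+* C) (σ : C →+* B) (hs : ∀ c, π (σ c) = c) (M : Mdl Cᵐᵒᵖ) :
    ∃ (T X : Mdl Bᵐᵒᵖ) (i : T →ₗ[Bᵐᵒᵖ] X) (p : X →ₗ[Bᵐᵒᵖ] modAlong π M),
        IsTensorKer π σ M T ∧ IsInducedAlong σ M X ∧
        Function.Injective i ∧ Function.Surjective p ∧
        LinearMap.range i = LinearMap.ker p := by
  obtain ⟨T, hT⟩ := exists_tensorKer π σ M
  obtain ⟨β, h1, h2, h3, h4, hU⟩ := id hT
  have hz2 : ∀ m, β m 0 = 0 := fun m => by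
    have := h2 m 0 0
    rwa [add_zero, left_eq_add] at this
  have hz1 : ∀ e, β 0 e = 0 := fun e => by
    have := h1 0 0 e
    rwa [add_zero, left_eq_add] at this
  let inst : Module Bᵐᵒᵖ (T × M) :=
    { smul := fun b x => (b • x.1 + β x.2 (kPart π σ hs b.unop), op (π b.unop) • x.2)
      one_smul := by
        rintro ⟨t, m⟩
        refine Prod.ext ?_ ?_
        · change (1 : Bᵐᵒᵖ) • t + β m (kPart π σ hs 1) = t
          have : kPart π σ hs 1 = 0 := Subtype.ext (by simp [kPart])
          rw [this, hz2, one_smul, add_zero]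
        · change op (π 1) • m = m
          rw [map_one, op_one, one_smul]
      mul_smul := by
        rintro a b ⟨t, m⟩
        refine Prod.ext ?_ ?_
        · change (a * b) • t + β m (kPart π σ hs (b.unop * a.unop)) =
            a • (b • t + β m (kPart π σ hs b.unop)) +
              β (op (π b.unop) • m) (kPart π σ hs a.unop)
          have : kPart π σ hs (b.unop * a.unop) = kRight π (kPart π σ hs b.unop) a.unop +
              kInl π σ (π b.unop) (kPart π σ hs a.unop) := Subtype.ext (by
                simp [kPart, kRight, kInl]; noncomm_ring)
          rw [this, h2, h3, h4, smul_add, mul_smul, op_unop, add_assoc]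
        · change op (π (b.unop * a.unop)) • m = op (π a.unop) • op (π b.unop) • m
          rw [map_mul, op_mul, mul_smul]
      smul_zero := by
        intro a
        refine Prod.ext ?_ ?_
        · change a • (0 : T) + β 0 _ = 0
          rw [smul_zero, hz1, add_zero]
        · exact smul_zero _
      smul_add := by
        rintro a ⟨t, m⟩ ⟨t', m'⟩
        refine Prod.ext ?_ ?_
        · change a • (t + t') + β (m + m') _ = (a • t + β m _) + (a • t' + β m' _)
          rw [smul_add, h1]; abel
        · exact smul_add _ _ _
      add_smul := by
        rintro a b ⟨t, m⟩
        refine Prod.ext ?_ ?_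
        · change (a + b) • t + β m (kPart π σ hs (a.unop + b.unop)) =
            (a • t + β m (kPart π σ hs a.unop)) + (b • t + β m (kPart π σ hs b.unop))
          have : kPart π σ hs (a.unop + b.unop) =
              kPart π σ hs a.unop + kPart π σ hs b.unop := Subtype.ext (by
                simp [kPart]; abel)
          rw [this, h2, add_smul]; abel
        · change op (π (a.unop + b.unop)) • m = op (π a.unop) • m + op (π b.unop) • m
          rw [map_add, MulOpposite.op_add, add_smul]
      zero_smul := by
        rintro ⟨t, m⟩
        refine Prod.ext ?_ ?_
        · change (0 : Bᵐᵒᵖ) • t + β m (kPart π σ hs 0) = 0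
          have : kPart π σ hs 0 = 0 := Subtype.ext (by simp [kPart])
          rw [this, hz2, zero_smul, add_zero]
        · change op (π 0) • m = 0
          rw [map_zero, op_zero, zero_smul] }
  have hsm : ∀ (b : B) (t : T) (m : M),
      op b • ((t, m) : T × M) = (op b • t + β m (kPart π σ hs b), op (π b) • m) :=
    fun _ _ _ => rfl
  let i : T →ₗ[Bᵐᵒᵖ] (T × M) :=
    { toFun := fun t => (t, 0)
      map_add' := fun t t' => by rw [Prod.mk_add_mk, add_zero]
      map_smul' := fun b t => by
        change _ = op b.unop • ((t, 0) : T × M)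
        rw [hsm, hz1, add_zero, smul_zero, op_unop] }
  let p : (T × M) →ₗ[Bᵐᵒᵖ] modAlong π M :=
    { toFun := fun x => x.2
      map_add' := fun _ _ => rfl
      map_smul' := fun _ _ => rfl }
  refine ⟨T, ModuleCat.of Bᵐᵒᵖ (T × M), i, p, hT, ?_, ?_, ?_, ?_⟩
  · refine ⟨AddMonoidHom.inr T M, ?_, ?_⟩
    · intro c m
      change ((0, op c • m) : T × M) = op (σ c) • ((0, m) : T × M)
      have : kPart π σ hs (σ c) = 0 := Subtype.ext (by simp [kPart, hs])
      rw [hsm, this, hz2, hs, smul_zero, add_zero]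
    · intro Y ψ hψ
      obtain ⟨g, hg, hgu⟩ := hU Y (fun m e => op e.1 • ψ m)
        (fun m m' e => by rw [map_add, smul_add])
        (fun m e e' => by
          change op (e.1 + e'.1) • ψ m = _
          rw [MulOpposite.op_add, add_smul])
        (fun b m e => by
          change op (e.1 * b) • ψ m = _
          rw [op_mul, mul_smul])
        (fun c m e => by
          change op e.1 • ψ (op c • m) = op (σ c * e.1) • ψ m
          rw [hψ, op_mul, mul_smul])
      let h : (T × M) →ₗ[Bᵐᵒᵖ] Y :=
        { toFun := fun x => g x.1 + ψ x.2
          map_add' := fun x y => by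
            rw [Prod.fst_add, Prod.snd_add, map_add, map_add]; abel
          map_smul' := by
            rintro b ⟨t, m⟩
            change g (b • t + β m (kPart π σ hs b.unop)) + ψ (op (π b.unop) • m) =
              b • (g t + ψ m)
            rw [map_add, map_smul, hg, hψ, smul_add, add_assoc, ← add_smul, ← MulOpposite.op_add]
            congr 2
            simp [kPart] }
      refine ⟨h, ?_, ?_⟩
      · intro m
        change g 0 + ψ m = ψ m
        rw [map_zero, zero_add]
      · intro h' hh'
        replace hh' : ∀ m : M, h' ((0, m) : T × M) = ψ m := hh'
        have e1 : h'.comp i = g := hgu _ (fun m e => by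
          have he : π e.1 = 0 := RingHom.mem_ker.mp e.2
          have hk : kPart π σ hs e.1 = e := Subtype.ext (by simp [kPart, he])
          have : i (β m e) = op e.1 • ((0, m) : T × M) := by
            rw [hsm, hk, he, op_zero, zero_smul, smul_zero, zero_add]; rfl
          change h' (i (β m e)) = op e.1 • ψ m
          rw [this, ← hh']
          exact h'.map_smul (op e.1) ((0, m) : T × M))
        refine LinearMap.ext ?_
        rintro ⟨t, m⟩
        change h' ((t, m) : T × M) = g t + ψ m
        rw [← hh', ← e1]
        change _ = h' ((t, 0) : T × M) + h' ((0, m) : T × M)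
        refine Eq.trans ?_ (h'.map_add ((t, 0) : T × M) ((0, m) : T × M))
        change h' _ = h' ((t + 0, 0 + m) : T × M)
        rw [add_zero, zero_add]
  · intro t t' h
    exact congrArg Prod.fst h
  · intro m
    exact ⟨((0, m) : T × M), rfl⟩
  · refine Submodule.ext ?_
    rintro ⟨t, m⟩
    constructor
    · rintro ⟨t', ht⟩
      exact (congrArg Prod.snd ht).symm
    · intro hm
      replace hm : m = 0 := hm
      exact ⟨t, by rw [hm]; rfl⟩

theorem exists_homKer (π : B →+* C) (σ : C →+* B) (M : Mdl Cᵐᵒᵖ) :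
    ∃ T : Mdl Bᵐᵒᵖ, IsHomKer π σ M T := by
  let S : AddSubgroup (RingHom.ker π →+ M) :=
    { carrier := {f | ∀ (c : C) e, f (kRight π e (σ c)) = op c • f e}
      add_mem' := fun {f g} hf hg c e => by
        rw [AddMonoidHom.add_apply, AddMonoidHom.add_apply, hf, hg, smul_add]
      zero_mem' := fun c e => by simp
      neg_mem' := fun {f} hf c e => by
        rw [AddMonoidHom.neg_apply, AddMonoidHom.neg_apply, hf, smul_neg] }
  have kl_add : ∀ b e e', kLeft π b (e + e') = kLeft π b e + kLeft π b e' :=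
    fun b e e' => Subtype.ext (mul_add b e.1 e'.1)
  let inst : Module Bᵐᵒᵖ S :=
    { smul := fun b f => ⟨AddMonoidHom.mk' (fun e => f.1 (kLeft π b.unop e))
          (fun e e' => by rw [kl_add, map_add]), fun c e => by
            change f.1 (kLeft π b.unop (kRight π e (σ c))) = op c • f.1 (kLeft π b.unop e)
            rw [← f.2 c]
            exact congrArg f.1 (Subtype.ext (mul_assoc _ _ _).symm)⟩
      one_smul := fun f => Subtype.ext (AddMonoidHom.ext fun e =>
        congrArg f.1 (Subtype.ext (one_mul e.1)))
      mul_smul := fun a b f => Subtype.ext (AddMonoidHom.ext fun e =>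
        congrArg f.1 (Subtype.ext (mul_assoc b.unop a.unop e.1)))
      smul_zero := fun a => rfl
      smul_add := fun a f g => rfl
      add_smul := fun a b f => Subtype.ext (AddMonoidHom.ext fun e => by
        refine Eq.trans (congrArg f.1 (Subtype.ext (add_mul a.unop b.unop e.1)) :
          _ = f.1 (kLeft π a.unop e + kLeft π b.unop e)) ?_
        rw [map_add]; rfl)
      zero_smul := fun f => Subtype.ext (AddMonoidHom.ext fun e => by
        refine Eq.trans (congrArg f.1 (Subtype.ext (zero_mul e.1)) : _ = f.1 0) ?_
        rw [map_zero]; rfl) }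
  refine ⟨ModuleCat.of Bᵐᵒᵖ S, fun f e => f.1 e, fun _ _ _ => rfl, fun t e e' => map_add t.1 e e',
    fun _ _ _ => rfl, fun c t e => t.2 c e, ?_⟩
  intro Z δ h1 h2 h3 h4
  let h : Z →ₗ[Bᵐᵒᵖ] S :=
    { toFun := fun z => ⟨AddMonoidHom.mk' (δ z) (h2 z), fun c e => h4 c z e⟩
      map_add' := fun z z' => Subtype.ext (AddMonoidHom.ext fun e => h1 z z' e)
      map_smul' := fun b z => Subtype.ext (AddMonoidHom.ext fun e => h3 b.unop z e) }
  refine ⟨h, fun _ _ => rfl, ?_⟩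
  intro h' hh'
  exact LinearMap.ext fun z => Subtype.ext (AddMonoidHom.ext fun e => hh' z e)

theorem second_sequence (π : B →+* C) (σ : C →+* B) (hs : ∀ c, π (σ c) = c) (M : Mdl Cᵐᵒᵖ) :
    ∃ (X' T' : Mdl Bᵐᵒᵖ) (i' : modAlong π M →ₗ[Bᵐᵒᵖ] X') (p' : X' →ₗ[Bᵐᵒᵖ] T'),
        IsCoinducedAlong σ M X' ∧ IsHomKer π σ M T' ∧
        Function.Injective i' ∧ Function.Surjective p' ∧
        LinearMap.range i' = LinearMap.ker p' := by
  obtain ⟨T, hT⟩ := exists_homKer π σ M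
  obtain ⟨ε, h1, h2, h3, h4, hU⟩ := id hT
  have hz2 : ∀ t, ε t 0 = 0 := fun t => by
    have := h2 t 0 0
    rwa [add_zero, left_eq_add] at this
  have hz1 : ∀ e, ε 0 e = 0 := fun e => by
    have := h1 0 0 e
    rwa [add_zero, left_eq_add] at this
  let inst : Module Bᵐᵒᵖ (M × T) :=
    { smul := fun b x => (op (π b.unop) • x.1 + ε x.2 (kPart π σ hs b.unop), b • x.2)
      one_smul := by
        rintro ⟨m, t⟩
        refine Prod.ext ?_ (one_smul _ _)
        change op (π 1) • m + ε t (kPart π σ hs 1) = m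
        have : kPart π σ hs 1 = 0 := Subtype.ext (by simp [kPart])
        rw [this, hz2, map_one, op_one, one_smul, add_zero]
      mul_smul := by
        rintro a b ⟨m, t⟩
        refine Prod.ext ?_ (mul_smul _ _ _)
        change op (π (b.unop * a.unop)) • m + ε t (kPart π σ hs (b.unop * a.unop)) =
            op (π a.unop) • (op (π b.unop) • m + ε t (kPart π σ hs b.unop)) +
              ε (op b.unop • t) (kPart π σ hs a.unop)
        have : kPart π σ hs (b.unop * a.unop) =
            kRight π (kPart π σ hs b.unop) (σ (π a.unop)) +
              kLeft π b.unop (kPart π σ hs a.unop) := Subtype.ext (by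
                simp [kPart, kRight, kLeft]; noncomm_ring)
        rw [this, h2, h3, h4, smul_add, map_mul, op_mul, mul_smul, add_assoc]
      smul_zero := by
        intro a
        refine Prod.ext ?_ (smul_zero _)
        change op (π a.unop) • (0 : M) + ε 0 _ = 0
        rw [smul_zero, hz1, add_zero]
      smul_add := by
        rintro a ⟨m, t⟩ ⟨m', t'⟩
        refine Prod.ext ?_ (smul_add _ _ _)
        change op (π a.unop) • (m + m') + ε (t + t') _ =
          (op (π a.unop) • m + ε t _) + (op (π a.unop) • m' + ε t' _)
        rw [smul_add, h1]; abel
      add_smul := by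
        rintro a b ⟨m, t⟩
        refine Prod.ext ?_ (add_smul _ _ _)
        change op (π (a.unop + b.unop)) • m + ε t (kPart π σ hs (a.unop + b.unop)) =
            (op (π a.unop) • m + ε t (kPart π σ hs a.unop)) +
            (op (π b.unop) • m + ε t (kPart π σ hs b.unop))
        have : kPart π σ hs (a.unop + b.unop) =
              kPart π σ hs a.unop + kPart π σ hs b.unop := Subtype.ext (by
                simp [kPart]; abel)
        rw [this, h2, map_add, MulOpposite.op_add, add_smul]; abel
      zero_smul := by
        rintro ⟨m, t⟩
        refine Prod.ext ?_ (zero_smul _ _)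
        change op (π 0) • m + ε t (kPart π σ hs 0) = 0
        have : kPart π σ hs 0 = 0 := Subtype.ext (by simp [kPart])
        rw [this, hz2, map_zero, op_zero, zero_smul, add_zero] }
  have hsm : ∀ (b : B) (m : M) (t : T),
      op b • ((m, t) : M × T) = (op (π b) • m + ε t (kPart π σ hs b), op b • t) :=
    fun _ _ _ => rfl
  let i : modAlong π M →ₗ[Bᵐᵒᵖ] (M × T) :=
    { toFun := fun m => ((m : M), (0 : T))
      map_add' := fun m m' => by
        refine Prod.ext rfl ?_
        exact (add_zero (0 : T)).symm
      map_smul' := fun b m => by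
        refine Prod.ext ?_ (smul_zero b).symm
        have key : ∀ m₀ : M, op (π b.unop) • m₀ =
            op (π b.unop) • m₀ + ε 0 (kPart π σ hs b.unop) := fun m₀ => by rw [hz1, add_zero]
        exact key m }
  let p : (M × T) →ₗ[Bᵐᵒᵖ] T :=
    { toFun := fun x => x.2
      map_add' := fun _ _ => rfl
      map_smul' := fun _ _ => rfl }
  refine ⟨ModuleCat.of Bᵐᵒᵖ (M × T), T, i, p, ?_, hT, ?_, ?_, ?_⟩
  · refine ⟨AddMonoidHom.fst M T, ?_, ?_⟩
    · rintro c ⟨m, t⟩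
      change op (π (σ c)) • m + ε t (kPart π σ hs (σ c)) = op c • m
      have : kPart π σ hs (σ c) = 0 := Subtype.ext (by simp [kPart, hs])
      rw [this, hz2, hs, add_zero]
    · intro Y ψ hψ
      obtain ⟨g, hg, hgu⟩ := hU Y (fun y e => ψ (op e.1 • y))
        (fun y y' e => by rw [smul_add, map_add])
        (fun y e e' => by
          change ψ (op (e.1 + e'.1) • y) = _
          rw [MulOpposite.op_add, add_smul, map_add])
        (fun b y e => by
          change ψ (op e.1 • op b • y) = ψ (op (b * e.1) • y)
          rw [op_mul, mul_smul])
        (fun c y e => by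
          change ψ (op (e.1 * σ c) • y) = op c • ψ (op e.1 • y)
          rw [op_mul, mul_smul, hψ])
      let h : Y →ₗ[Bᵐᵒᵖ] (M × T) :=
        { toFun := fun y => (ψ y, g y)
          map_add' := fun x y => by
            rw [map_add, map_add]; rfl
          map_smul' := by
            intro b y
            refine Prod.ext ?_ (g.map_smul b y)
            change ψ (b • y) = op (π b.unop) • ψ y + ε (g y) (kPart π σ hs b.unop)
            rw [hg, ← hψ, ← map_add, ← add_smul, ← MulOpposite.op_add]
            congr 2
            simp [kPart] }
      refine ⟨h, fun y => rfl, ?_⟩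
      intro h' hh'
      let k' : Y →ₗ[Bᵐᵒᵖ] (M × T) := h'
      have hk' : ∀ y, (k' y).1 = ψ y := hh'
      have e1 : p.comp k' = g := hgu _ (fun y e => by
        have he : π e.1 = 0 := RingHom.mem_ker.mp e.2
        have hk : kPart π σ hs e.1 = e := Subtype.ext (by simp [kPart, he])
        change ε (k' y).2 e = ψ (op e.1 • y)
        rw [← hk', map_smul]
        change _ = op (π e.1) • (k' y).1 + ε (k' y).2 (kPart π σ hs e.1)
        rw [hk, he, op_zero, zero_smul, zero_add])
      refine LinearMap.ext fun y => Prod.ext (hk' y) ?_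
      change (p.comp k') y = g y
      rw [e1]
  · intro t t' h
    exact congrArg Prod.fst h
  · intro t
    exact ⟨((0, t) : M × T), rfl⟩
  · refine Submodule.ext ?_
    rintro ⟨m, t⟩
    constructor
    · rintro ⟨t', ht⟩
      exact (congrArg Prod.snd ht).symm
    · intro hm
      replace hm : t = 0 := hm
      exact ⟨m, by rw [hm]; rfl⟩

end SplitExtProof

/-- For a split extension `B` of `C` by a nilpotent kernel `E = ker π`, every
`C`-module `M` yields two short exact sequences of `B`-modules:
`0 → M ⊗_C E → M ⊗_C B → M → 0` and `0 → M → D(B ⊗_C DM) → D(E ⊗_C DM) → 0`. -/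
theorem split_extension_exact_sequences
    (k : Type) [Field k] (B C : Type) [Ring B] [Ring C]
    [Algebra k B] [Algebra k C] [FiniteDimensional k B] [FiniteDimensional k C]
    (π : B →+* C) (σ : C →+* B) (hsplit : π.comp σ = RingHom.id C)
    (hnilp : ∃ n : ℕ, ∀ f : Fin n → B, (∀ i, π (f i) = 0) → (List.ofFn f).prod = 0)
    (M : Mdl Cᵐᵒᵖ) [Module.Finite Cᵐᵒᵖ M] :
    (∃ (T X : Mdl Bᵐᵒᵖ) (i : T →ₗ[Bᵐᵒᵖ] X) (p : X →ₗ[Bᵐᵒᵖ] modAlong π M),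
        IsTensorKer π σ M T ∧ IsInducedAlong σ M X ∧
        Function.Injective i ∧ Function.Surjective p ∧
        LinearMap.range i = LinearMap.ker p) ∧
    (∃ (X' T' : Mdl Bᵐᵒᵖ) (i' : modAlong π M →ₗ[Bᵐᵒᵖ] X') (p' : X' →ₗ[Bᵐᵒᵖ] T'),
        IsCoinducedAlong σ M X' ∧ IsHomKer π σ M T' ∧
        Function.Injective i' ∧ Function.Surjective p' ∧
        LinearMap.range i' = LinearMap.ker p') := by
  have hs : ∀ c, π (σ c) = c := fun c => RingHom.congr_fun hsplit c
  exact ⟨first_sequence π σ hs M, second_sequence π σ hs M⟩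
end
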